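/- Let X be a real d-dimensional tensor of size n₁ × ⋯ × n_d admitting a Tucker decomposition X = C ×₁ A⁽¹⁾ ×₂ A⁽²⁾ ⋯ ×_d A⁽ᵈ⁾ with core C ∈ ℝ^{r₁ × ⋯ × r_d} and factor matrices A⁽ᵏ⁾ ∈ ℝ^{n_k × r_k} each having full column rank (the decomposition is independent). Then α ‖C‖_F ≤ ‖X‖_F ≤ β ‖C‖_F, where β = ∏_{k=1}^{d} ‖A⁽ᵏ⁾‖₂ and α = β / ∏_{k=1}^{d} κ(A⁽ᵏ⁾), with ‖A‖₂ the spectral norm (largest singular value) and κ(A) = σ_max(A)/σ_min(A) the condition number of A (σ_min(A) denoting the smallest singular value of the full-column-rank matrix A); equivalently, α = ∏_{k=1}^{d} σ_min(A⁽ᵏ⁾). -/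

import Mathlib

open scoped BigOperators

/-- A real `d`-dimensional tensor of size `n 0 × n 1 × ⋯ × n (d-1)`:
a function from `(Fin (n 0)) × ⋯ × (Fin (n (d-1)))` to `ℝ`. -/
def Tensor {d : ℕ} (n : Fin d → ℕ) : Type :=
  ((k : Fin d) → Fin (n k)) → ℝ

/-- Transport a tensor along an equality of size functions. -/
def Tensor.cast {d : ℕ} {n n' : Fin d → ℕ} (h : n = n') (X : Tensor n) : Tensor n' :=
  fun i => X fun k => Fin.cast (congrFun h k).symm (i k)

/-- The `j`-mode product of a tensor `X` of size `n 0 × ⋯ × n (d-1)` with a matrix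
`U ∈ ℝ^{m × n j}`:
`(X ×_j U)(i₁,…,i_{j-1},k,i_{j+1},…,i_d) = ∑_{i_j} X(i₁,…,i_j,…,i_d) · U(k, i_j)`. -/
def modeProd {d : ℕ} {n : Fin d → ℕ} (j : Fin d) {m : ℕ}
    (X : Tensor n) (U : Matrix (Fin m) (Fin (n j)) ℝ) :
    Tensor (Function.update n j m) := fun i =>
  ∑ t : Fin (n j),
    X (fun k =>
        if h : k = j then Fin.cast (congrArg n h).symm t
        else Fin.cast (Function.update_of_ne h m n) (i k)) *
      U (Fin.cast (Function.update_self j m n) (i j)) t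

/-- Apply the mode-`k` product with `A k` successively for the first `j` modes
`k = 0, 1, …, j-1`. -/
def multiProd {d : ℕ} (n m : Fin d → ℕ)
    (A : (k : Fin d) → Matrix (Fin (m k)) (Fin (n k)) ℝ) (X : Tensor n) :
    (j : ℕ) → j ≤ d → Tensor (fun k => if (k : ℕ) < j then m k else n k)
  | 0, _ => Tensor.cast (by funext k; simp) X
  | j + 1, h =>
    Tensor.cast
      (by
        funext k
        by_cases hk : k = (⟨j, h⟩ : Fin d)
        · subst hk; simp
        · rw [Function.update_of_ne hk]
          have hkj : (k : ℕ) ≠ j := fun hc => hk (Fin.ext hc)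
          by_cases hlt : (k : ℕ) < j
          · simp [hlt, Nat.lt_succ_of_lt hlt]
          · have h1 : ¬ (k : ℕ) < j + 1 := by omega
            simp [hlt, h1])
      (modeProd (⟨j, h⟩ : Fin d)
        (multiProd n m A X j (Nat.le_of_succ_le h))
        (fun a b => A ⟨j, h⟩ a (Fin.cast (by simp) b)))

/-- `Y = X ×₁ A⁽¹⁾ ×₂ A⁽²⁾ ⋯ ×_d A⁽ᵈ⁾`: the mode-`k` product with `A⁽ᵏ⁾` is applied
successively for `k = 1, …, d`. -/
def fullProd {d : ℕ} {n m : Fin d → ℕ}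
    (A : (k : Fin d) → Matrix (Fin (m k)) (Fin (n k)) ℝ) (X : Tensor n) : Tensor m :=
  Tensor.cast (by funext k; simp [k.isLt]) (multiProd n m A X d le_rfl)


/-- The Frobenius norm of a tensor: the square root of the sum of the squares of all
its entries. -/
noncomputable def frobT {d : ℕ} {n : Fin d → ℕ} (X : Tensor n) : ℝ :=
  Real.sqrt (∑ i : (k : Fin d) → Fin (n k), X i ^ 2)

/-- The Euclidean norm of a vector. -/
noncomputable def euclNorm {q : ℕ} (v : Fin q → ℝ) : ℝ :=
  Real.sqrt (∑ i, v i ^ 2)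

/-- The spectral norm of a real matrix: the operator norm with respect to Euclidean
norms, i.e. the supremum of `‖M x‖₂` over unit vectors `x`. -/
noncomputable def specNorm {p q : ℕ} (M : Matrix (Fin p) (Fin q) ℝ) : ℝ :=
  sSup {c : ℝ | ∃ x : Fin q → ℝ, euclNorm x = 1 ∧ c = euclNorm (M.mulVec x)}

/-- The smallest singular value of a matrix (for a full-column-rank matrix):
`σ_min(M) = inf` over unit vectors `x` of `‖M x‖₂`. -/
noncomputable def sigmaMin {p q : ℕ} (M : Matrix (Fin p) (Fin q) ℝ) : ℝ :=
  sInf {c : ℝ | ∃ x : Fin q → ℝ, euclNorm x = 1 ∧ c = euclNorm (M.mulVec x)}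

/-- The condition number `κ(M) = σ_max(M)/σ_min(M)`. -/
noncomputable def condNum {p q : ℕ} (M : Matrix (Fin p) (Fin q) ℝ) : ℝ :=
  specNorm M / sigmaMin M

theorem euclNorm_nonneg {q : ℕ} (v : Fin q → ℝ) : 0 ≤ euclNorm v := Real.sqrt_nonneg _

theorem euclNorm_sq {q : ℕ} (v : Fin q → ℝ) : euclNorm v ^ 2 = ∑ i, v i ^ 2 :=
  Real.sq_sqrt (Finset.sum_nonneg fun _ _ => sq_nonneg _)

theorem euclNorm_smul {q : ℕ} (c : ℝ) (v : Fin q → ℝ) :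
    euclNorm (c • v) = |c| * euclNorm v := by
  simp only [euclNorm, Pi.smul_apply, smul_eq_mul, mul_pow, ← Finset.mul_sum]
  rw [Real.sqrt_mul (sq_nonneg c), Real.sqrt_sq_eq_abs]

theorem euclNorm_mulVec_eq {p q : ℕ} (M : Matrix (Fin p) (Fin q) ℝ) {x : Fin q → ℝ}
    (hx : euclNorm x ≠ 0) :
    ∃ y, euclNorm y = 1 ∧ euclNorm (M.mulVec x) = euclNorm (M.mulVec y) * euclNorm x := by
  refine ⟨(euclNorm x)⁻¹ • x, ?_, ?_⟩
  · rw [euclNorm_smul, abs_inv, abs_of_nonneg (euclNorm_nonneg x), inv_mul_cancel₀ hx]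
  · rw [Matrix.mulVec_smul, euclNorm_smul, abs_inv, abs_of_nonneg (euclNorm_nonneg x)]
    field_simp

theorem eq_zero_of_euclNorm_eq_zero {q : ℕ} {x : Fin q → ℝ} (hx : euclNorm x = 0) : x = 0 := by
  have h : ∑ i, x i ^ 2 = 0 := by rw [← euclNorm_sq, hx]; norm_num
  rw [Finset.sum_eq_zero_iff_of_nonneg fun _ _ => sq_nonneg _] at h
  funext i
  simpa using h i (Finset.mem_univ i)

theorem sigmaMin_nonneg {p q : ℕ} (M : Matrix (Fin p) (Fin q) ℝ) : 0 ≤ sigmaMin M := by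
  refine Real.sInf_nonneg ?_
  rintro _ ⟨x, -, rfl⟩
  exact euclNorm_nonneg _

theorem specNorm_nonneg {p q : ℕ} (M : Matrix (Fin p) (Fin q) ℝ) : 0 ≤ specNorm M := by
  refine Real.sSup_nonneg ?_
  rintro _ ⟨x, -, rfl⟩
  exact euclNorm_nonneg _

theorem bddAbove_euclNorm_mulVec {p q : ℕ} (M : Matrix (Fin p) (Fin q) ℝ) :
    BddAbove {c : ℝ | ∃ x : Fin q → ℝ, euclNorm x = 1 ∧ c = euclNorm (M.mulVec x)} := by
  refine ⟨Real.sqrt (∑ i, ∑ j, M i j ^ 2), ?_⟩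
  rintro _ ⟨x, hx, rfl⟩
  refine Real.sqrt_le_sqrt (Finset.sum_le_sum fun i _ => ?_)
  have h := Finset.sum_mul_sq_le_sq_mul_sq Finset.univ (M i) x
  rwa [← euclNorm_sq x, hx, one_pow, mul_one] at h

theorem euclNorm_mulVec_le {p q : ℕ} (M : Matrix (Fin p) (Fin q) ℝ) (x : Fin q → ℝ) :
    euclNorm (M.mulVec x) ≤ specNorm M * euclNorm x := by
  by_cases hx : euclNorm x = 0
  · simp [eq_zero_of_euclNorm_eq_zero hx, euclNorm]
  · obtain ⟨y, hy, h⟩ := euclNorm_mulVec_eq M hx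
    rw [h]
    exact mul_le_mul_of_nonneg_right (le_csSup (bddAbove_euclNorm_mulVec M) ⟨y, hy, rfl⟩)
      (euclNorm_nonneg x)

theorem sigmaMin_mul_euclNorm_le {p q : ℕ} (M : Matrix (Fin p) (Fin q) ℝ) (x : Fin q → ℝ) :
    sigmaMin M * euclNorm x ≤ euclNorm (M.mulVec x) := by
  by_cases hx : euclNorm x = 0
  · simpa [hx] using euclNorm_nonneg (M.mulVec x)
  · obtain ⟨y, hy, h⟩ := euclNorm_mulVec_eq M hx
    rw [h]
    refine mul_le_mul_of_nonneg_right (csInf_le ⟨0, ?_⟩ ⟨y, hy, rfl⟩) (euclNorm_nonneg x)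
    rintro _ ⟨x, -, rfl⟩
    exact euclNorm_nonneg _

theorem specNorm_castCols {p q q' : ℕ} (h : q' = q) (M : Matrix (Fin p) (Fin q) ℝ) :
    specNorm (fun a (b : Fin q') => M a (Fin.cast h b)) = specNorm M := by
  subst h; rfl

theorem sigmaMin_castCols {p q q' : ℕ} (h : q' = q) (M : Matrix (Fin p) (Fin q) ℝ) :
    sigmaMin (fun a (b : Fin q') => M a (Fin.cast h b)) = sigmaMin M := by
  subst h; rfl

theorem specNorm_div_condNum_le {p q : ℕ} (M : Matrix (Fin p) (Fin q) ℝ) :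
    specNorm M / condNum M ≤ sigmaMin M := by
  rw [condNum]
  by_cases h : specNorm M = 0
  · simpa [h] using sigmaMin_nonneg M
  · exact (div_div_cancel₀ h).le

theorem frobT_nonneg {d : ℕ} {n : Fin d → ℕ} (X : Tensor n) : 0 ≤ frobT X := Real.sqrt_nonneg _

theorem frobT_sq {d : ℕ} {n : Fin d → ℕ} (X : Tensor n) :
    frobT X ^ 2 = ∑ i : (k : Fin d) → Fin (n k), X i ^ 2 :=
  Real.sq_sqrt (Finset.sum_nonneg fun _ _ => sq_nonneg _)

theorem frobT_cast {d : ℕ} {n n' : Fin d → ℕ} (h : n = n') (X : Tensor n) :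
    frobT (Tensor.cast h X) = frobT X := by
  subst h; rfl

/-- The mode-`j` fiber of `X` through the remaining coordinates `f`. -/
def Tensor.fiber {d : ℕ} {n : Fin d → ℕ} (X : Tensor n) (j : Fin d)
    (f : (k : {k // k ≠ j}) → Fin (n k)) (t : Fin (n j)) : ℝ :=
  X ((Equiv.piSplitAt j fun k => Fin (n k)).symm (t, f))

theorem frobT_sq_eq_sum_fiber {d : ℕ} {n : Fin d → ℕ} (X : Tensor n) (j : Fin d) :
    frobT X ^ 2 = ∑ f, euclNorm (X.fiber j f) ^ 2 := by
  simp only [frobT_sq, euclNorm_sq]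
  rw [← (Equiv.piSplitAt j fun k => Fin (n k)).symm.sum_comp, Fintype.sum_prod_type_right]
  rfl

/-- Multi-indices of a mode-`j` product, split into the mode-`j` coordinate and the rest. -/
def updateSplitAt {d : ℕ} (n : Fin d → ℕ) (j : Fin d) (m : ℕ) :
    ((k : Fin d) → Fin (Function.update n j m k)) ≃ Fin m × ((k : {k // k ≠ j}) → Fin (n k)) :=
  (Equiv.piSplitAt j fun k => Fin (Function.update n j m k)).trans
    ((finCongr (Function.update_self j m n)).prodCongr
      (Equiv.piCongrRight fun k => finCongr (Function.update_of_ne k.2 m n)))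

theorem modeProd_updateSplitAt_symm {d : ℕ} {n : Fin d → ℕ} (j : Fin d) {m : ℕ} (X : Tensor n)
    (U : Matrix (Fin m) (Fin (n j)) ℝ) (a : Fin m) (f : (k : {k // k ≠ j}) → Fin (n k)) :
    modeProd j X U ((updateSplitAt n j m).symm (a, f)) = U.mulVec (X.fiber j f) a := by
  simp only [modeProd, Matrix.mulVec, dotProduct]
  refine Finset.sum_congr rfl fun t _ => ?_
  rw [mul_comm]
  congr 1
  · congr 1
    simp [updateSplitAt, Equiv.piSplitAt]
  · rw [Tensor.fiber]
    congr 1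
    funext k
    by_cases h : k = j
    · subst h; simp [Equiv.piSplitAt]
    · simp [h, updateSplitAt, Equiv.piSplitAt]

theorem frobT_modeProd_sq {d : ℕ} {n : Fin d → ℕ} (j : Fin d) {m : ℕ} (X : Tensor n)
    (U : Matrix (Fin m) (Fin (n j)) ℝ) :
    frobT (modeProd j X U) ^ 2 = ∑ f, euclNorm (U.mulVec (X.fiber j f)) ^ 2 := by
  simp only [frobT_sq, euclNorm_sq]
  rw [← (updateSplitAt n j m).symm.sum_comp, Fintype.sum_prod_type_right]
  simp only [modeProd_updateSplitAt_symm]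

theorem frobT_modeProd_le {d : ℕ} {n : Fin d → ℕ} (j : Fin d) {m : ℕ} (X : Tensor n)
    (U : Matrix (Fin m) (Fin (n j)) ℝ) :
    frobT (modeProd j X U) ≤ specNorm U * frobT X := by
  refine le_of_sq_le_sq ?_ (mul_nonneg (specNorm_nonneg U) (frobT_nonneg X))
  rw [mul_pow, frobT_modeProd_sq, frobT_sq_eq_sum_fiber X j, Finset.mul_sum]
  refine Finset.sum_le_sum fun f _ => ?_
  rw [← mul_pow]
  exact pow_le_pow_left₀ (euclNorm_nonneg _) (euclNorm_mulVec_le U _) 2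

theorem sigmaMin_mul_frobT_le {d : ℕ} {n : Fin d → ℕ} (j : Fin d) {m : ℕ} (X : Tensor n)
    (U : Matrix (Fin m) (Fin (n j)) ℝ) :
    sigmaMin U * frobT X ≤ frobT (modeProd j X U) := by
  refine le_of_sq_le_sq ?_ (frobT_nonneg _)
  rw [mul_pow, frobT_modeProd_sq, frobT_sq_eq_sum_fiber X j, Finset.mul_sum]
  refine Finset.sum_le_sum fun f _ => ?_
  rw [← mul_pow]
  exact pow_le_pow_left₀ (mul_nonneg (sigmaMin_nonneg U) (euclNorm_nonneg _))
    (sigmaMin_mul_euclNorm_le U _) 2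

theorem prod_filter_val_lt_succ {d : ℕ} (g : Fin d → ℝ) {j : ℕ} (h : j < d) :
    ∏ k with k.val < j + 1, g k = g ⟨j, h⟩ * ∏ k with k.val < j, g k := by
  rw [← Finset.prod_insert (by simp)]
  congr 1
  ext k
  simp [Fin.ext_iff, Nat.le_iff_lt_or_eq, or_comm]

theorem frobT_multiProd_le {d : ℕ} {n m : Fin d → ℕ}
    (A : (k : Fin d) → Matrix (Fin (m k)) (Fin (n k)) ℝ) (X : Tensor n) (j : ℕ) (hj : j ≤ d) :
    frobT (multiProd n m A X j hj) ≤ (∏ k with k.val < j, specNorm (A k)) * frobT X := by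
  induction j with
  | zero => rw [multiProd, frobT_cast]; simp
  | succ j ih =>
    rw [multiProd, frobT_cast, prod_filter_val_lt_succ _ hj, mul_assoc]
    refine (frobT_modeProd_le _ _ _).trans ?_
    rw [specNorm_castCols]
    exact mul_le_mul_of_nonneg_left (ih _) (specNorm_nonneg _)

theorem prod_sigmaMin_mul_frobT_le_frobT_multiProd {d : ℕ} {n m : Fin d → ℕ}
    (A : (k : Fin d) → Matrix (Fin (m k)) (Fin (n k)) ℝ) (X : Tensor n) (j : ℕ) (hj : j ≤ d) :
    (∏ k with k.val < j, sigmaMin (A k)) * frobT X ≤ frobT (multiProd n m A X j hj) := by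
  induction j with
  | zero => rw [multiProd, frobT_cast]; simp
  | succ j ih =>
    rw [multiProd, frobT_cast, prod_filter_val_lt_succ _ hj, mul_assoc]
    refine le_trans ?_ (sigmaMin_mul_frobT_le _ _ _)
    rw [sigmaMin_castCols]
    exact mul_le_mul_of_nonneg_left (ih _) (sigmaMin_nonneg _)

/-- if `X = C ×₁ A⁽¹⁾ ×₂ A⁽²⁾ ⋯ ×_d A⁽ᵈ⁾` is an independent Tucker
decomposition (each factor matrix `A⁽ᵏ⁾` has full column rank, i.e. `x ↦ A⁽ᵏ⁾ x` is
injective), then `α ‖C‖_F ≤ ‖X‖_F ≤ β ‖C‖_F`, where `β = ∏ₖ ‖A⁽ᵏ⁾‖₂` and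
`α = β / ∏ₖ κ(A⁽ᵏ⁾)`. -/
theorem tucker_frobenius_bounds {d : ℕ} {n r : Fin d → ℕ} (C : Tensor r)
    (A : (k : Fin d) → Matrix (Fin (n k)) (Fin (r k)) ℝ)
    (hfull : ∀ k, Function.Injective ((A k).mulVec))
    (X : Tensor n) (hX : X = fullProd A C) :
    ((∏ k, specNorm (A k)) / ∏ k, condNum (A k)) * frobT C ≤ frobT X ∧
      frobT X ≤ (∏ k, specNorm (A k)) * frobT C := by
  subst hX
  have hlo := prod_sigmaMin_mul_frobT_le_frobT_multiProd A C d le_rfl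
  have hhi := frobT_multiProd_le A C d le_rfl
  simp only [Fin.is_lt, Finset.filter_true] at hlo hhi
  rw [fullProd, frobT_cast]
  refine ⟨le_trans (mul_le_mul_of_nonneg_right ?_ (frobT_nonneg C)) hlo, hhi⟩
  rw [← Finset.prod_div_distrib]
  exact Finset.prod_le_prod
    (fun k _ => div_nonneg (specNorm_nonneg _)
      (div_nonneg (specNorm_nonneg _) (sigmaMin_nonneg _)))
    fun k _ => specNorm_div_condNum_le (A k)
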